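/- arXiv:1703.01695 — 2 statements merged into one kernel-verified Lean document; each statement's English description precedes it below -/
import Mathlib

section
/- Let A be a self-adjoint operator on H and K a compact self-adjoint (bounded) operator on H. Then the operator A + K with domain dom A is self-adjoint and σ_ess(A + K) = σ_ess(A). -/
open Filter Metric Topology LinearPMap

noncomputable section

variable {H : Type*} [NormedAddCommGroup H] [InnerProductSpace ℂ H] [CompleteSpace H]

/-- A (possibly unbounded) self-adjoint operator: densely defined and equal to its adjoint. -/
def IsSelfAdjointOp (A : H →ₗ.[ℂ] H) : Prop :=
  Dense (A.domain : Set H) ∧ A.adjoint = A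

/-- The essential spectrum of a (partially defined) operator: the set of real `t` admitting an
orthonormal sequence in the domain along which `‖A xₙ - t • xₙ‖ → 0`. -/
def essSpec (A : H →ₗ.[ℂ] H) : Set ℝ :=
  {t | ∃ x : ℕ → A.domain, Orthonormal ℂ (fun n => (x n : H)) ∧
    Tendsto (fun n => ‖A (x n) - (t : ℂ) • (x n : H)‖) atTop (𝓝 0)}

/-- Weyl–von Neumann equivalence: `u A u* + K = B` for some unitary `u` and
compact self-adjoint `K`. -/
def WvNEquiv (A B : H →ₗ.[ℂ] H) : Prop :=
  ∃ (u : H ≃ₗᵢ[ℂ] H) (K : H →L[ℂ] H), IsCompactOperator K ∧ IsSelfAdjoint K ∧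
    B.domain = A.domain.map (u.toLinearEquiv : H →ₗ[ℂ] H) ∧
    ∀ (x : A.domain) (hx : u (x : H) ∈ B.domain), B ⟨u (x : H), hx⟩ = u (A x) + K (u (x : H))

/-- `M` has no large holes at infinity. -/
def NoLargeHoles (M : Set ℝ) : Prop :=
  M.Nonempty ∧ ∀ ε > 0, ∃ N > 0, ∀ l : ℝ, l ∉ M → |l| > N → infDist l M < ε

end

/-- The operator `A + K` with domain `dom A`, for a bounded operator `K`. -/
def addBounded {H : Type*} [NormedAddCommGroup H] [InnerProductSpace ℂ H] [CompleteSpace H]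
    (A : H →ₗ.[ℂ] H) (K : H →L[ℂ] H) : H →ₗ.[ℂ] H :=
  ⟨A.domain, A.toFun + (K : H →ₗ[ℂ] H).comp A.domain.subtype⟩

theorem addBounded_apply {H : Type*} [NormedAddCommGroup H] [InnerProductSpace ℂ H]
    [CompleteSpace H] (A : H →ₗ.[ℂ] H) (K : H →L[ℂ] H) (x : A.domain) :
    addBounded A K x = A x + K x := rfl

theorem addBounded_addBounded_neg {H : Type*} [NormedAddCommGroup H] [InnerProductSpace ℂ H]
    [CompleteSpace H] (A : H →ₗ.[ℂ] H) (K : H →L[ℂ] H) :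
    addBounded (addBounded A K) (-K) = A := by
  refine LinearPMap.ext rfl fun x hx hx' => ?_
  change (A ⟨x, hx'⟩ + K x) + (-K) x = A ⟨x, hx'⟩
  simp

/-- A bounded self-adjoint perturbation of a self-adjoint operator is self-adjoint. -/
theorem IsSelfAdjointOp.addBounded {H : Type*} [NormedAddCommGroup H] [InnerProductSpace ℂ H]
    [CompleteSpace H] {A : H →ₗ.[ℂ] H} (hA : IsSelfAdjointOp A) {K : H →L[ℂ] H}
    (hK : IsSelfAdjoint K) : IsSelfAdjointOp (addBounded A K) := by
  obtain ⟨hd, hA⟩ := hA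
  have hd' : Dense ((_root_.addBounded A K).domain : Set H) := hd
  have hKs (x y : H) : inner ℂ (K x) y = inner ℂ x (K y) := hK.isSymmetric x y
  have hAf : A.IsFormalAdjoint A := by
    have h := adjoint_isFormalAdjoint hd
    rwa [hA] at h
  have hle : _root_.addBounded A K ≤ (_root_.addBounded A K).adjoint := by
    refine IsFormalAdjoint.le_adjoint hd' fun x y => ?_
    change inner ℂ (A x + K x) (y : H) = inner ℂ (x : H) (A y + K y)
    rw [inner_add_left, inner_add_right, hKs]
    exact congrArg (· + _) (hAf x y)
  refine ⟨hd', (eq_of_le_of_domain_eq hle (le_antisymm hle.1 fun y hy => ?_)).symm⟩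
  change y ∈ A.domain
  rw [← hA]
  refine mem_adjoint_domain_of_exists y ⟨(_root_.addBounded A K).adjoint ⟨y, hy⟩ - K y, fun x => ?_⟩
  have h := adjoint_isFormalAdjoint hd' ⟨y, hy⟩ x
  rw [addBounded_apply, inner_add_right] at h
  rw [inner_sub_left, h, hKs, add_sub_cancel_right]

/-- Orthonormal sequences converge weakly to zero. -/
theorem Orthonormal.tendsto_inner_zero {𝕜 E : Type*} [RCLike 𝕜] [NormedAddCommGroup E]
    [InnerProductSpace 𝕜 E] {x : ℕ → E} (hx : Orthonormal 𝕜 x) (y : E) :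
    Tendsto (fun n => inner 𝕜 (x n) y) atTop (𝓝 0) := by
  have h := (hx.inner_products_summable (x := y)).tendsto_atTop_zero
  rw [tendsto_zero_iff_norm_tendsto_zero]
  simpa using h.sqrt

/-- Compact operators map orthonormal sequences to null sequences. -/
theorem IsCompactOperator.tendsto_orthonormal_zero {𝕜 E F : Type*} [RCLike 𝕜]
    [NormedAddCommGroup E] [InnerProductSpace 𝕜 E] [CompleteSpace E]
    [NormedAddCommGroup F] [InnerProductSpace 𝕜 F] [CompleteSpace F]
    {K : E →L[𝕜] F} (hK : IsCompactOperator K) {x : ℕ → E} (hx : Orthonormal 𝕜 x) :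
    Tendsto (fun n => K (x n)) atTop (𝓝 0) := by
  refine (hK.isCompact_closure_image_closedBall 1).tendsto_nhds_of_unique_mapClusterPt
    (Eventually.of_forall fun n => subset_closure ⟨x n, by simp [hx.1 n], rfl⟩) fun y _ hy => ?_
  have h1 : MapClusterPt (inner 𝕜 y y) atTop (fun n => inner 𝕜 (K (x n)) y) :=
    hy.continuousAt_comp (f := fun z => inner 𝕜 z y) (by fun_prop)
  have h2 : Tendsto (fun n => inner 𝕜 (K (x n)) y) atTop (𝓝 0) := by
    simpa only [ContinuousLinearMap.adjoint_inner_right] using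
      hx.tendsto_inner_zero (ContinuousLinearMap.adjoint K y)
  have h3 : ClusterPt (inner 𝕜 y y) (𝓝 (0 : 𝕜)) := ClusterPt.mono h1 h2
  exact inner_self_eq_zero.1 (eq_of_nhds_neBot h3)

/-- A compact perturbation does not shrink the essential spectrum. -/
theorem essSpec_subset_essSpec_addBounded {H : Type*} [NormedAddCommGroup H]
    [InnerProductSpace ℂ H] [CompleteSpace H] (A : H →ₗ.[ℂ] H) {K : H →L[ℂ] H}
    (hK : IsCompactOperator K) : essSpec A ⊆ essSpec (addBounded A K) := by
  rintro t ⟨x, hx, ht⟩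
  refine ⟨x, hx, ?_⟩
  have h := ((tendsto_zero_iff_norm_tendsto_zero.2 ht).add (hK.tendsto_orthonormal_zero hx)).norm
  rw [add_zero, norm_zero] at h
  refine h.congr fun n => ?_
  rw [addBounded_apply, sub_add_eq_add_sub]

theorem isSelfAdjointOp_addBounded_and_essSpec_eq
    {H : Type*} [NormedAddCommGroup H] [InnerProductSpace ℂ H] [CompleteSpace H]
    [TopologicalSpace.SeparableSpace H] (hdim : ¬ FiniteDimensional ℂ H)
    (A : H →ₗ.[ℂ] H) (hA : IsSelfAdjointOp A)
    (K : H →L[ℂ] H) (hKc : IsCompactOperator K) (hKsa : IsSelfAdjoint K) :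
    IsSelfAdjointOp (addBounded A K) ∧ essSpec (addBounded A K) = essSpec A := by
  refine ⟨hA.addBounded hKsa, Set.Subset.antisymm ?_ (essSpec_subset_essSpec_addBounded A hKc)⟩
  have h := essSpec_subset_essSpec_addBounded (addBounded A K) (K := -K) hKc.neg
  rwa [addBounded_addBounded_neg] at h
end

section
/- Let d ∈ (0, 1], let (λ_k)_{k≥1} be a real sequence with λ_1 > 1 and λ_{k+1} > 2 λ_k for all k, and let (μ_m)_{m≥1} be a real sequence with |λ_k − μ_m| > d/2 for all k, m. Let A be the diagonal self-adjoint operator on ℓ²(ℕ≥1, ℂ) whose diagonal entry at index ⟨k,1⟩ is λ_k and at index ⟨k,m⟩ (m ≥ 2) is μ_k, and let B be the diagonal self-adjoint operator whose entry at index ⟨k,1⟩ is λ_{k+1} − d/4 and at index ⟨k,m⟩ (m ≥ 2) is μ_k. Then A and B are NOT Weyl–von Neumann equivalent: there exist no unitary u on ℓ² and compact self-adjoint operator K with uAu* + K = B. -/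
open Filter Metric Topology

noncomputable section

variable {ι : Type*}

/-- The domain of the diagonal operator. -/
def diagDomain (c : ι → ℝ) : Submodule ℂ (lp (fun _ : ι => ℂ) 2) where
  carrier := {x | Memℓp (fun n => (c n : ℂ) * x n) 2}
  add_mem' := by
    intro x y hx hy
    show Memℓp _ 2
    have h := hx.add hy
    convert h using 1
    funext n
    simp [lp.coeFn_add, Pi.add_apply, mul_add]
  zero_mem' := by
    show Memℓp _ 2
    have h : Memℓp (0 : ∀ _ : ι, ℂ) 2 := zero_memℓp
    convert h using 1
    funext n
    simp
  smul_mem' := by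
    intro a x hx
    show Memℓp _ 2
    have h := hx.const_smul a
    convert h using 1
    funext n
    simp [lp.coeFn_smul, Pi.smul_apply]
    ring

/-- The diagonal operator `diag c` on `ℓ²`. -/
def diag (c : ι → ℝ) : lp (fun _ : ι => ℂ) 2 →ₗ.[ℂ] lp (fun _ : ι => ℂ) 2 where
  domain := diagDomain c
  toFun :=
    { toFun := fun x => ⟨fun n => (c n : ℂ) * (x : lp (fun _ : ι => ℂ) 2) n, x.2⟩
      map_add' := by
        intro x y
        apply Subtype.ext
        funext n
        simp [lp.coeFn_add, Pi.add_apply, mul_add]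
        rfl
      map_smul' := by
        intro a x
        apply Subtype.ext
        funext n
        simp [lp.coeFn_smul, Pi.smul_apply]
        ring }

end

noncomputable section

/-- The pairing `⟨k, m⟩ = 2 ^ (k - 1) * (2 * m - 1)`, a bijection `ℕ≥1 × ℕ≥1 → ℕ≥1`. -/
def pairPNat (k m : ℕ+) : ℕ+ :=
  ⟨2 ^ ((k : ℕ) - 1) * (2 * (m : ℕ) - 1), by
    have hm : 1 ≤ (m : ℕ) := m.one_le
    have h1 : 0 < 2 ^ ((k : ℕ) - 1) := pow_pos (by norm_num) _
    have h2 : 0 < 2 * (m : ℕ) - 1 := by omega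
    exact Nat.mul_pos h1 h2⟩

end

/-- A compact operator is not bounded below on an orthonormal sequence. -/
theorem IsCompactOperator.exists_norm_apply_lt_of_orthonormal
    {H : Type*} [NormedAddCommGroup H] [InnerProductSpace ℂ H] [CompleteSpace H]
    {T : H →L[ℂ] H} (hT : IsCompactOperator T) {e : ℕ → H} (he : Orthonormal ℂ e)
    {c : ℝ} (hc : 0 < c) : ∃ n, ‖T (e n)‖ < c := by
  by_contra! hlow
  have hcpt := IsCompactOperator.isCompact_closure_image_closedBall
    (f := (T : H →ₗ[ℂ] H)) hT 1
  obtain ⟨y, -, φ, hφ, hlim⟩ := hcpt.tendsto_subseq (x := fun n => T (e n)) fun n =>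
    subset_closure ⟨e n, by simp [he.1 n], rfl⟩
  have hy : c ≤ ‖y‖ := ge_of_tendsto hlim.norm (Eventually.of_forall fun n => hlow _)
  have hinner : Tendsto (fun n => inner ℂ (T (e (φ n))) y) atTop (𝓝 (inner ℂ y y)) :=
    hlim.inner tendsto_const_nhds
  have hzero : Tendsto (fun n => inner ℂ (T (e (φ n))) y) atTop (𝓝 0) := by
    have hbessel := (he.inner_products_summable
      (ContinuousLinearMap.adjoint T y)).tendsto_atTop_zero.comp hφ.tendsto_atTop
    rw [tendsto_zero_iff_norm_tendsto_zero]
    have hsqrt := hbessel.sqrt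
    simpa [Function.comp_def, ContinuousLinearMap.adjoint_inner_right] using hsqrt
  have hyy := inner_self_eq_zero.mp (tendsto_nhds_unique hinner hzero)
  rw [hyy, norm_zero] at hy
  exact hc.not_ge hy

theorem orthonormal_lp_single {ι : Type*} [DecidableEq ι] :
    Orthonormal ℂ fun i : ι => (lp.single 2 i 1 : lp (fun _ : ι => ℂ) 2) := by
  rw [orthonormal_iff_ite]
  intro i j
  rw [lp.inner_single_left, lp.single_apply, Pi.single_apply]
  split_ifs <;> simp

theorem lp_single_mem_diagDomain {ι : Type*} [DecidableEq ι] (c : ι → ℝ) (i : ι) :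
    (lp.single 2 i 1 : lp (fun _ : ι => ℂ) 2) ∈ diagDomain c := by
  show Memℓp _ 2
  convert lp.memℓp (lp.single 2 i (c i : ℂ) : lp (fun _ : ι => ℂ) 2) using 1
  funext n
  by_cases h : n = i
  · subst h; simp
  · simp [h]

theorem diag_lp_single {ι : Type*} [DecidableEq ι] (c : ι → ℝ) (i : ι) :
    diag c ⟨lp.single 2 i 1, lp_single_mem_diagDomain c i⟩ =
      (c i : ℂ) • (lp.single 2 i 1 : lp (fun _ : ι => ℂ) 2) := by
  ext n
  show (c n : ℂ) * (lp.single 2 i 1 : lp (fun _ : ι => ℂ) 2) n = _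
  rw [lp.coeFn_smul, Pi.smul_apply, smul_eq_mul]
  by_cases h : n = i
  · subst h; simp
  · simp [h]

theorem le_norm_diag_sub_smul {ι : Type*} {c : ι → ℝ} {r δ : ℝ} (hδ : 0 ≤ δ)
    (h : ∀ i, δ ≤ |c i - r|) (x : (diag c).domain) :
    δ * ‖(x : lp (fun _ : ι => ℂ) 2)‖ ≤ ‖diag c x - (r : ℂ) • (x : lp (fun _ : ι => ℂ) 2)‖ := by
  have hmono : ‖(δ : ℂ) • (x : lp (fun _ : ι => ℂ) 2)‖ ≤
      ‖diag c x - (r : ℂ) • (x : lp (fun _ : ι => ℂ) 2)‖ := by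
    refine lp.norm_mono two_ne_zero fun i => ?_
    have hi : (diag c x - (r : ℂ) • (x : lp (fun _ : ι => ℂ) 2)) i =
        ((c i - r : ℝ) : ℂ) * (x : lp (fun _ : ι => ℂ) 2) i := by
      show (c i : ℂ) * (x : lp (fun _ : ι => ℂ) 2) i - (r : ℂ) * _ = _
      push_cast; ring
    rw [hi, lp.coeFn_smul, Pi.smul_apply, norm_smul, norm_mul, Complex.norm_real,
      Complex.norm_real, Real.norm_eq_abs, Real.norm_eq_abs, abs_of_nonneg hδ]
    exact mul_le_mul_of_nonneg_right (h i) (norm_nonneg _)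
  rwa [norm_smul, Complex.norm_real, Real.norm_eq_abs, abs_of_nonneg hδ] at hmono

theorem exists_pairPNat_eq (n : ℕ+) : ∃ k m, pairPNat k m = n := by
  obtain ⟨k, t, ⟨s, rfl⟩, hn⟩ := Nat.exists_eq_two_pow_mul_odd n.ne_zero
  refine ⟨k.succPNat, s.succPNat, PNat.eq ?_⟩
  show 2 ^ (k + 1 - 1) * (2 * (s + 1) - 1) = (n : ℕ)
  rw [hn, Nat.add_sub_cancel, show 2 * (s + 1) - 1 = 2 * s + 1 by omega]

theorem pairPNat_one_injective : Function.Injective fun k : ℕ+ => pairPNat k 1 := by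
  intro j k h
  have h' : 2 ^ ((j : ℕ) - 1) * (2 * 1 - 1) = 2 ^ ((k : ℕ) - 1) * (2 * 1 - 1) :=
    congrArg PNat.val h
  have hpow := Nat.pow_right_injective le_rfl (by simpa using h')
  have hj := j.pos
  have hk := k.pos
  exact PNat.eq (by omega)

theorem one_lt_of_two_mul_lt_succ {l : ℕ+ → ℝ} (hl1 : 1 < l 1)
    (hgrow : ∀ k : ℕ+, 2 * l k < l (k + 1)) (k : ℕ+) : 1 < l k := by
  induction k using PNat.recOn with
  | one => exact hl1
  | succ k ih => linarith [hgrow k]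

theorem add_one_lt_of_two_mul_lt_succ {l : ℕ+ → ℝ} (hl1 : 1 < l 1)
    (hgrow : ∀ k : ℕ+, 2 * l k < l (k + 1)) {j k : ℕ+} (hjk : j < k) : l j + 1 < l k := by
  have hstep (i : ℕ+) : l i + 1 < l (i + 1) := by
    linarith [hgrow i, one_lt_of_two_mul_lt_succ hl1 hgrow i]
  induction k using PNat.recOn with
  | one => exact (not_lt_one hjk).elim
  | succ k ih =>
    rcases (PNat.lt_add_one_iff.mp hjk).lt_or_eq with h | rfl
    · linarith [ih h, hstep k]
    · exact hstep j

noncomputable section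

theorem not_wvnEquiv_of_large_gaps
    (d : ℝ) (hd0 : 0 < d) (hd1 : d ≤ 1)
    (l μ : ℕ+ → ℝ) (hl1 : 1 < l 1) (hgrow : ∀ k : ℕ+, 2 * l k < l (k + 1))
    (hsep : ∀ k m : ℕ+, d / 2 < |l k - μ m|)
    (a b : ℕ+ → ℝ)
    (ha1 : ∀ k : ℕ+, a (pairPNat k 1) = l k)
    (ham : ∀ k m : ℕ+, 2 ≤ m → a (pairPNat k m) = μ k)
    (hb1 : ∀ k : ℕ+, b (pairPNat k 1) = l (k + 1) - d / 4)
    (hbm : ∀ k m : ℕ+, 2 ≤ m → b (pairPNat k m) = μ k) :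
    ¬ WvNEquiv (diag a) (diag b) := by
  rintro ⟨u, K, hK, -, hdom, hu⟩
  have hgap (k n : ℕ+) : d / 4 ≤ |b n - l k| := by
    obtain ⟨j, m, rfl⟩ := exists_pairPNat_eq n
    by_cases hm : m = 1
    · subst hm
      rw [hb1]
      rcases lt_trichotomy (j + 1) k with h | h | h
      · have := add_one_lt_of_two_mul_lt_succ hl1 hgrow h
        exact le_abs.mpr (Or.inr (by linarith))
      · rw [h]
        exact le_abs.mpr (Or.inr (by linarith))
      · have := add_one_lt_of_two_mul_lt_succ hl1 hgrow h
        exact le_abs.mpr (Or.inl (by linarith))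
    · have hm2 : 2 ≤ m := PNat.add_one_le_iff.mpr (lt_of_le_of_ne one_le (Ne.symm hm))
      rw [hbm j m hm2, abs_sub_comm]
      linarith [hsep k j]
  let s : ℕ → ℕ+ := fun n => pairPNat n.succPNat 1
  have hs : Function.Injective s := pairPNat_one_injective.comp Nat.succPNat_injective
  have he := (orthonormal_lp_single.comp s hs).comp_linearIsometryEquiv u
  obtain ⟨n, hn⟩ := hK.exists_norm_apply_lt_of_orthonormal he (c := d / 4) (by linarith)
  have hmem : u (lp.single 2 (s n) 1) ∈ (diag b).domain := by
    rw [hdom]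
    exact ⟨_, lp_single_mem_diagDomain a (s n), rfl⟩
  have heq := hu ⟨_, lp_single_mem_diagDomain a (s n)⟩ hmem
  have hle := le_norm_diag_sub_smul (by linarith) (hgap n.succPNat) ⟨_, hmem⟩
  rw [heq, diag_lp_single, show a (s n) = l n.succPNat from ha1 _, map_smul,
    add_sub_cancel_left] at hle
  have hnorm : ‖u (lp.single 2 (s n) 1)‖ = 1 := he.1 n
  rw [hnorm, mul_one] at hle
  exact hn.not_ge hle

end
end
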